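/- arXiv:2204.04493 — 2 statements merged into one kernel-verified Lean document; each statement's English description precedes it below -/
import Mathlib

section
/- Uniqueness of the entanglement-left inverse in the equal-dimension case. Let A and B be multimatrix algebras with dim A = dim B, let h ≥ 1, let ω ∈ M_h(ℂ) be invertible with Tr(ω†ω) = 1, and let W_ω := |w_ω⟩⟨w_ω| with w_ω := ∑_{k<h} e_k⊗ω e_k be the pure state defined by ω. Let M : A⊗M_h(ℂ) → B be a channel which is entanglement-reversible with respect to W_ω. Then the entanglement-left inverse is unique: if N, N' : B⊗M_h(ℂ) → A are channels with N((M⊗id)(x⊗W_ω)) = x = N'((M⊗id)(x⊗W_ω)) for all x ∈ A, then N = N'. -/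
noncomputable section

open Matrix Kronecker
open scoped ComplexOrder

namespace EntInvPaper

/-- The matrix algebra `M_n(ℂ)` with row/column index type `n`. -/
abbrev Mat (n : Type) : Type := Matrix n n ℂ

/-- The amplification `id_{M_t} ⊗ Φ` of a linear map between matrix algebras,
as a plain function on matrices. -/
def amplL {n m : Type} (t : Type) (Φ : Mat n →ₗ[ℂ] Mat m) (X : Mat (t × n)) : Mat (t × m) :=
  Matrix.of fun p q => Φ (Matrix.of fun x y => X (p.1, x) (q.1, y)) p.2 q.2

/-- The amplification `Φ ⊗ id_{M_t}` of a linear map between matrix algebras. -/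
def amplR {n m : Type} (t : Type) (Φ : Mat n →ₗ[ℂ] Mat m) (X : Mat (n × t)) : Mat (m × t) :=
  Matrix.of fun p q => Φ (Matrix.of fun x y => X (x, p.2) (y, q.2)) p.1 q.1

/-- Complete positivity: every amplification `id_{M_k} ⊗ Φ` preserves positive
semidefiniteness. -/
def IsCP {n m : Type} [Fintype n] [Fintype m] (Φ : Mat n →ₗ[ℂ] Mat m) : Prop :=
  ∀ (k : ℕ) (X : Mat (Fin k × n)), X.PosSemidef → (amplL (Fin k) Φ X).PosSemidef

/-- A channel is a completely positive trace-preserving linear map. -/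
def IsChannel {n m : Type} [Fintype n] [Fintype m] (Φ : Mat n →ₗ[ℂ] Mat m) : Prop :=
  IsCP Φ ∧ ∀ X : Mat n, (Φ X).trace = X.trace

/-- A state: a positive semidefinite matrix of trace one. -/
def IsState {n : Type} [Fintype n] (ρ : Mat n) : Prop :=
  ρ.PosSemidef ∧ ρ.trace = 1

/-- The outer product `|v⟩⟨v|`. -/
def outer {n : Type} (v : n → ℂ) : Mat n :=
  Matrix.vecMulVec v (star v)

/-- `x ⊗ W`, with the tensor factors regrouped as `(a × h₁) × h₂`. -/
def tensorState {a h₁ h₂ : Type} (x : Mat a) (W : Mat (h₁ × h₂)) : Mat ((a × h₁) × h₂) :=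
  Matrix.reindex (Equiv.prodAssoc a h₁ h₂).symm (Equiv.prodAssoc a h₁ h₂).symm (x ⊗ₖ W)

/-- Swap the two tensor factors of a bipartite operator. -/
def swapState {h₁ h₂ : Type} (W : Mat (h₁ × h₂)) : Mat (h₂ × h₁) :=
  Matrix.reindex (Equiv.prodComm h₁ h₂) (Equiv.prodComm h₁ h₂) W

/-- Partial trace over the first tensor factor. -/
def ptraceFst {p t : Type} [Fintype p] (X : Mat (p × t)) : Mat t :=
  Matrix.of fun s s' => ∑ u : p, X (u, s) (u, s')

/-- Partial trace over the second tensor factor. -/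
def ptraceSnd {s t : Type} [Fintype t] (X : Mat (s × t)) : Mat s :=
  Matrix.of fun i i' => ∑ k : t, X (i, k) (i', k)

/-- `N` is an entanglement-left inverse of `M` with respect to the resource state `W`:
`N((M ⊗ id)(x ⊗ W)) = x` for all `x`. -/
def EntLeftInv {a b h₁ h₂ : Type} (M : Mat (a × h₁) →ₗ[ℂ] Mat b)
    (N : Mat (b × h₂) →ₗ[ℂ] Mat a) (W : Mat (h₁ × h₂)) : Prop :=
  ∀ x : Mat a, N (amplR h₂ M (tensorState x W)) = x

/-- `N` is an entanglement-right inverse of `M` with respect to `W`: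
`M((N ⊗ id)(y ⊗ Wᵠ)) = y` for all `y`, where `Wᵠ` is `W` with the factors swapped. -/
def EntRightInv {a b h₁ h₂ : Type} (M : Mat (a × h₁) →ₗ[ℂ] Mat b)
    (N : Mat (b × h₂) →ₗ[ℂ] Mat a) (W : Mat (h₁ × h₂)) : Prop :=
  ∀ y : Mat b, M (amplR h₁ N (tensorState y (swapState W))) = y

/-- `M` is entanglement-reversible with respect to `W`. -/
def EntReversible {a b h₁ h₂ : Type} [Fintype a] [Fintype b] [Fintype h₁] [Fintype h₂]
    (M : Mat (a × h₁) →ₗ[ℂ] Mat b) (W : Mat (h₁ × h₂)) : Prop :=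
  ∃ N : Mat (b × h₂) →ₗ[ℂ] Mat a, IsChannel N ∧ EntLeftInv M N W

/-- `M` is entanglement-invertible with respect to `W`. -/
def EntInvertible {a b h₁ h₂ : Type} [Fintype a] [Fintype b] [Fintype h₁] [Fintype h₂]
    (M : Mat (a × h₁) →ₗ[ℂ] Mat b) (W : Mat (h₁ × h₂)) : Prop :=
  ∃ N : Mat (b × h₂) →ₗ[ℂ] Mat a, IsChannel N ∧ EntLeftInv M N W ∧ EntRightInv M N W

/-- The canonical maximally entangled unit vector `Ω = (1/√h) ∑ₖ eₖ ⊗ eₖ`. -/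
def omegaVec (h : ℕ) : Fin h × Fin h → ℂ :=
  fun p => if p.1 = p.2 then ((Real.sqrt h : ℝ) : ℂ)⁻¹ else 0

/-- The canonical maximally entangled state `|Ω⟩⟨Ω|`. -/
def canME (h : ℕ) : Mat (Fin h × Fin h) := outer (omegaVec h)

/-- The vector `w_ω = ∑ₖ eₖ ⊗ ω eₖ` associated to a linear map `ω : ℂ^{h₁} → ℂ^{h₂}`. -/
def pureVec {h₁ h₂ : Type} (ω : Matrix h₂ h₁ ℂ) : h₁ × h₂ → ℂ := fun p => ω p.2 p.1

/-- The pure state `|w_ω⟩⟨w_ω|` defined by `ω`. -/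
def pureState {h₁ h₂ : Type} (ω : Matrix h₂ h₁ ℂ) : Mat (h₁ × h₂) := outer (pureVec ω)

/-- `V` is a Stinespring dilation of the channel `M`, with environment the second
tensor factor `ℂ^e`: `V` is an isometry and `M z = Tr_{ℂ^e}(V z V†)`. -/
def IsDilation {a h b e : ℕ} (M : Mat (Fin a × Fin h) →ₗ[ℂ] Mat (Fin b))
    (V : Matrix (Fin b × Fin e) (Fin a × Fin h) ℂ) : Prop :=
  Vᴴ * V = 1 ∧ ∀ z : Mat (Fin a × Fin h), M z = ptraceSnd (V * z * Vᴴ)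

/-- Minimality of a dilation: the vectors `(⟨y| ⊗ I)Vξ` span the environment. -/
def IsMinimalDilation {a h b e : ℕ} (V : Matrix (Fin b × Fin e) (Fin a × Fin h) ℂ) : Prop :=
  Submodule.span ℂ { v : Fin e → ℂ |
    ∃ (y : Fin b → ℂ) (ξ : Fin a × Fin h → ℂ),
      v = fun f => ∑ j, (starRingEnd ℂ) (y j) * (V *ᵥ ξ) (j, f) } = ⊤

/-- The rearrangement `Ṽ` of `V : ℂ^a ⊗ ℂ^h → ℂ^b ⊗ ℂ^e`, with entries
`Ṽ_{(k,j),(i,f)} = V_{(j,f),(i,k)}`. -/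
def rearrange {a b h e : ℕ} (V : Matrix (Fin b × Fin e) (Fin a × Fin h) ℂ) :
    Matrix (Fin h × Fin b) (Fin a × Fin e) ℂ :=
  Matrix.of fun p q => V (p.2, q.2) (q.1, p.1)

/-- The candidate bi-isometry `S = (ω ⊗ I_b) · Ṽ · (I_a ⊗ κ)`. -/
def biIsometryCandidate {a b h e : ℕ} (ω : Mat (Fin h))
    (V : Matrix (Fin b × Fin e) (Fin a × Fin h) ℂ) (κ : Mat (Fin e)) :
    Matrix (Fin h × Fin b) (Fin a × Fin e) ℂ :=
  (ω ⊗ₖ (1 : Mat (Fin b))) * rearrange V * ((1 : Mat (Fin a)) ⊗ₖ κ)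

/-- The contraction `(⟨Φ| ⊗ I)X(|Φ⟩ ⊗ I)` of the first tensor factor of `X`
against the vector `Φ`. -/
def contract {p t : Type} [Fintype p] (Φ : p → ℂ) (X : Mat (p × t)) : Mat t :=
  Matrix.of fun s s' => ∑ u : p, ∑ u' : p, (starRingEnd ℂ) (Φ u) * X (u, s) (u', s') * Φ u'

/-- Conjugation `X ↦ C X C†` as a linear map. -/
def conjBy {p q : Type} [Fintype q] (C : Matrix p q ℂ) : Mat q →ₗ[ℂ] Mat p where
  toFun X := C * X * Cᴴ
  map_add' X Y := by
    show C * (X + Y) * Cᴴ = C * X * Cᴴ + C * Y * Cᴴ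
    rw [Matrix.mul_add, Matrix.add_mul]
  map_smul' c X := by
    show C * (c • X) * Cᴴ = c • (C * X * Cᴴ)
    rw [Matrix.mul_smul, Matrix.smul_mul]

end EntInvPaper

noncomputable section

open Matrix Kronecker
open scoped ComplexOrder

namespace EntInvPaper

/-- Amplification `Φ ⊗ id_{M_t}` for a linear map between multimatrix algebras. -/
def piAmplR {ι κ : Type} {A : ι → Type} {B : κ → Type} (t : Type)
    (Φ : ((i : ι) → Mat (A i)) →ₗ[ℂ] (j : κ) → Mat (B j))
    (X : (i : ι) → Mat (A i × t)) : (j : κ) → Mat (B j × t) :=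
  fun j => Matrix.of fun p q =>
    Φ (fun i => Matrix.of fun x y => X i (x, p.2) (y, q.2)) j p.1 q.1

/-- Amplification `id_{M_t} ⊗ Φ` for a linear map between multimatrix algebras. -/
def piAmplL {ι κ : Type} {A : ι → Type} {B : κ → Type} (t : Type)
    (Φ : ((i : ι) → Mat (A i)) →ₗ[ℂ] (j : κ) → Mat (B j))
    (X : (i : ι) → Mat (t × A i)) : (j : κ) → Mat (t × B j) :=
  fun j => Matrix.of fun p q =>
    Φ (fun i => Matrix.of fun x y => X i (p.1, x) (q.1, y)) j p.2 q.2

/-- Complete positivity for maps between multimatrix algebras. -/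
def PiIsCP {ι κ : Type} {A : ι → Type} {B : κ → Type}
    [∀ i, Fintype (A i)] [∀ j, Fintype (B j)]
    (Φ : ((i : ι) → Mat (A i)) →ₗ[ℂ] (j : κ) → Mat (B j)) : Prop :=
  ∀ (k : ℕ) (X : (i : ι) → Mat (Fin k × A i)),
    (∀ i, (X i).PosSemidef) → ∀ j, (piAmplL (Fin k) Φ X j).PosSemidef

/-- A channel between multimatrix algebras: completely positive and preserving
the total trace. -/
def PiIsChannel {ι κ : Type} [Fintype ι] [Fintype κ] {A : ι → Type} {B : κ → Type}
    [∀ i, Fintype (A i)] [∀ j, Fintype (B j)]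
    (Φ : ((i : ι) → Mat (A i)) →ₗ[ℂ] (j : κ) → Mat (B j)) : Prop :=
  PiIsCP Φ ∧ ∀ X, ∑ j, (Φ X j).trace = ∑ i, (X i).trace

/-- A positive semidefinite element of a multimatrix algebra of total trace one. -/
def PiIsState {ι : Type} [Fintype ι] {A : ι → Type} [∀ i, Fintype (A i)]
    (ρ : (i : ι) → Mat (A i)) : Prop :=
  (∀ i, (ρ i).PosSemidef) ∧ ∑ i, (ρ i).trace = 1

/-- `N` is an entanglement-left inverse of `M : A ⊗ M_{h₁} → B` with respect to
the resource state `W`. -/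
def PiEntLeftInv {m n h₁ h₂ : ℕ} {a : Fin m → ℕ} {b : Fin n → ℕ}
    (M : ((i : Fin m) → Mat (Fin (a i) × Fin h₁)) →ₗ[ℂ] (j : Fin n) → Mat (Fin (b j)))
    (N : ((j : Fin n) → Mat (Fin (b j) × Fin h₂)) →ₗ[ℂ] (i : Fin m) → Mat (Fin (a i)))
    (W : Mat (Fin h₁ × Fin h₂)) : Prop :=
  ∀ x : (i : Fin m) → Mat (Fin (a i)),
    N (piAmplR (Fin h₂) M fun i => tensorState (x i) W) = x

/-- `N` is an entanglement-right inverse of `M` with respect to `W`. -/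
def PiEntRightInv {m n h₁ h₂ : ℕ} {a : Fin m → ℕ} {b : Fin n → ℕ}
    (M : ((i : Fin m) → Mat (Fin (a i) × Fin h₁)) →ₗ[ℂ] (j : Fin n) → Mat (Fin (b j)))
    (N : ((j : Fin n) → Mat (Fin (b j) × Fin h₂)) →ₗ[ℂ] (i : Fin m) → Mat (Fin (a i)))
    (W : Mat (Fin h₁ × Fin h₂)) : Prop :=
  ∀ y : (j : Fin n) → Mat (Fin (b j)),
    M (piAmplR (Fin h₁) N fun j => tensorState (y j) (swapState W)) = y

/-- `M` is entanglement-reversible with respect to `W`. -/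
def PiEntReversible {m n h₁ h₂ : ℕ} {a : Fin m → ℕ} {b : Fin n → ℕ}
    (M : ((i : Fin m) → Mat (Fin (a i) × Fin h₁)) →ₗ[ℂ] (j : Fin n) → Mat (Fin (b j)))
    (W : Mat (Fin h₁ × Fin h₂)) : Prop :=
  ∃ N : ((j : Fin n) → Mat (Fin (b j) × Fin h₂)) →ₗ[ℂ] (i : Fin m) → Mat (Fin (a i)),
    PiIsChannel N ∧ PiEntLeftInv M N W

/-- `M` is entanglement-invertible with respect to `W`. -/
def PiEntInvertible {m n h₁ h₂ : ℕ} {a : Fin m → ℕ} {b : Fin n → ℕ}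
    (M : ((i : Fin m) → Mat (Fin (a i) × Fin h₁)) →ₗ[ℂ] (j : Fin n) → Mat (Fin (b j)))
    (W : Mat (Fin h₁ × Fin h₂)) : Prop :=
  ∃ N : ((j : Fin n) → Mat (Fin (b j) × Fin h₂)) →ₗ[ℂ] (i : Fin m) → Mat (Fin (a i)),
    PiIsChannel N ∧ PiEntLeftInv M N W ∧ PiEntRightInv M N W

end EntInvPaper

noncomputable section
open Matrix Kronecker
open scoped ComplexOrder
namespace EntInvPaper

theorem PiIsCP.piAmplL_posSemidef {ι κ : Type} {A : ι → Type} {B : κ → Type}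
    [∀ i, Fintype (A i)] [∀ j, Fintype (B j)]
    {Φ : ((i : ι) → Mat (A i)) →ₗ[ℂ] (j : κ) → Mat (B j)} (hΦ : PiIsCP Φ)
    {t : Type} [Fintype t] (X : (i : ι) → Mat (t × A i)) (hX : ∀ i, (X i).PosSemidef) (j : κ) :
    (piAmplL t Φ X j).PosSemidef := by
  classical
  let e := Fintype.equivFin t
  have key := hΦ (Fintype.card t)
    (fun i => (X i).submatrix (Prod.map e.symm id) (Prod.map e.symm id))
    (fun i => (hX i).submatrix _) j
  have := key.submatrix (Prod.map e id)
  convert this using 1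
  ext p q
  simp [piAmplL]

/-- A channel stays trace-preserving after amplification. -/
theorem PiIsChannel.sum_trace_piAmplL {ι κ : Type} [Fintype ι] [Fintype κ]
    {A : ι → Type} {B : κ → Type} [∀ i, Fintype (A i)] [∀ j, Fintype (B j)]
    {Φ : ((i : ι) → Mat (A i)) →ₗ[ℂ] (j : κ) → Mat (B j)} (hΦ : PiIsChannel Φ)
    {t : Type} [Fintype t] (X : (i : ι) → Mat (t × A i)) :
    ∑ j, (piAmplL t Φ X j).trace = ∑ i, (X i).trace := by
  have key (u : t) := hΦ.2 (fun i => Matrix.of fun x y => X i (u, x) (u, y))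
  simp only [Matrix.trace, Matrix.diag, piAmplL, Matrix.of_apply, Fintype.sum_prod_type] at key ⊢
  rw [Finset.sum_comm]
  simp_rw [key]
  rw [Finset.sum_comm]

/-- The block matrix with blocks `C u * ρ * (C v)ᴴ` is positive semidefinite. -/
theorem posSemidef_block_conj {t n : Type} [Fintype t] [Fintype n] {ρ : Mat n}
    (hρ : ρ.PosSemidef) (C : t → Mat n) :
    (Matrix.of fun p q : t × n => (C p.1 * ρ * (C q.1)ᴴ) p.2 q.2).PosSemidef := by
  exact hρ.mul_mul_conjTranspose_same (Matrix.of fun (p : t × n) y => C p.1 p.2 y)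

section

variable {ι κ : Type} {A : ι → Type} {B : κ → Type}
  [∀ i, Fintype (A i)] [∀ j, Fintype (B j)]
  {Φ : ((i : ι) → Mat (A i)) →ₗ[ℂ] (j : κ) → Mat (B j)}

theorem PiIsCP.block_posSemidef (hΦ : PiIsCP Φ) {t : Type} [Fintype t]
    {ρ : (i : ι) → Mat (A i)} (hρ : ∀ i, (ρ i).PosSemidef) (C : t → (i : ι) → Mat (A i)) (j : κ) :
    (Matrix.of fun p q : t × B j => Φ (C p.1 * ρ * star (C q.1)) j p.2 q.2).PosSemidef :=
  hΦ.piAmplL_posSemidef _ (fun i => posSemidef_block_conj (hρ i) fun u => C u i) j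

theorem PiIsCP.posSemidef (hΦ : PiIsCP Φ)
    {ρ : (i : ι) → Mat (A i)} (hρ : ∀ i, (ρ i).PosSemidef) (j : κ) :
    (Φ ρ j).PosSemidef :=
  (hΦ.piAmplL_posSemidef (t := Unit) (fun i => (ρ i).submatrix Prod.snd Prod.snd)
    (fun i => (hρ i).submatrix _) j).submatrix (fun x => ((), x))

theorem PiIsCP.sum_trace_nonneg (hΦ : PiIsCP Φ) {t : Type} [Fintype t]
    {ρ : (i : ι) → Mat (A i)} (hρ : ∀ i, (ρ i).PosSemidef) (C : t → (i : ι) → Mat (A i))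
    (D : t → (j : κ) → Mat (B j)) (j : κ) :
    0 ≤ ∑ u, ∑ v, ((star (D u) * Φ (C u * ρ * star (C v)) * D v) j).trace := by
  have h1 := ((hΦ.block_posSemidef hρ C j).conjTranspose_mul_mul_same
    (Matrix.of fun (p : t × B j) y => D p.1 j p.2 y)).trace_nonneg
  convert h1 using 1
  simp only [Matrix.trace, Matrix.diag, Matrix.mul_apply, Pi.mul_apply, Pi.star_apply,
    Fintype.sum_prod_type, Matrix.of_apply, Matrix.star_apply, Matrix.conjTranspose_apply,
    Finset.sum_mul]
  simp_rw [Finset.sum_comm (s := (Finset.univ : Finset t)) (t := (Finset.univ : Finset (B j)))]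
  refine Finset.sum_congr rfl fun x _ => ?_
  refine Finset.sum_congr rfl fun y _ => ?_
  rw [Finset.sum_comm, Finset.sum_comm]
  refine Finset.sum_congr rfl fun z _ => ?_
  rw [Finset.sum_comm]

variable [∀ i, DecidableEq (A i)]

theorem PiIsCP.map_star (hΦ : PiIsCP Φ) (x : (i : ι) → Mat (A i)) : Φ (star x) = star (Φ x) := by
  funext j
  have h1 := (hΦ.block_posSemidef (t := Fin 2) (ρ := 1) (fun i => Matrix.PosSemidef.one)
    ![1, star x] j).isHermitian
  ext p q
  have := h1.apply (1, p) (0, q)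
  simp only [Matrix.of_apply] at this
  simpa using this.symm

/-- A vector annihilated by the image of the unit is annihilated by the whole image of a
completely positive map. -/
theorem PiIsCP.mulVec_eq_zero (hΦ : PiIsCP Φ) {j : κ} {ψ : B j → ℂ} (hψ : Φ 1 j *ᵥ ψ = 0)
    (x : (i : ι) → Mat (A i)) : Φ x j *ᵥ ψ = 0 := by
  have h1 := hΦ.block_posSemidef (t := Fin 2) (ρ := 1) (fun i => Matrix.PosSemidef.one)
    ![1, x] j
  let v : Fin 2 × B j → ℂ := fun p => if p.1 = 0 then ψ p.2 else 0
  have h2 : (Matrix.of fun p q : Fin 2 × B j =>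
      Φ ((![1, x] : Fin 2 → _) p.1 * 1 * star ((![1, x] : Fin 2 → _) q.1)) j p.2 q.2) *ᵥ v =
      fun p => (Φ ((![1, x] : Fin 2 → _) p.1) j *ᵥ ψ) p.2 := by
    funext p
    simp [Matrix.mulVec, dotProduct, Fintype.sum_prod_type, v]
  have h3 : star v ⬝ᵥ ((Matrix.of fun p q : Fin 2 × B j =>
      Φ ((![1, x] : Fin 2 → _) p.1 * 1 * star ((![1, x] : Fin 2 → _) q.1)) j p.2 q.2) *ᵥ v) = 0 := by
    rw [h2]
    simp [dotProduct, Fintype.sum_prod_type, v, hψ]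
  rw [h1.dotProduct_mulVec_zero_iff, h2] at h3
  funext p
  simpa using congrFun h3 (1, p)

end

/-- The total trace of an element of a multimatrix algebra. -/
def piTrace {ι : Type} [Fintype ι] {A : ι → Type} [∀ i, Fintype (A i)] :
    ((i : ι) → Mat (A i)) →ₗ[ℂ] ℂ where
  toFun X := ∑ i, (X i).trace
  map_add' X Y := by simp [Finset.sum_add_distrib]
  map_smul' c X := by simp [Finset.mul_sum]

section

variable {ι κ : Type} [Fintype ι] [Fintype κ] {A : ι → Type} {B : κ → Type}
  [∀ i, Fintype (A i)] [∀ j, Fintype (B j)]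

theorem piTrace_apply (X : (i : ι) → Mat (A i)) : piTrace X = ∑ i, (X i).trace := rfl

theorem piTrace_mul_comm (X Y : (i : ι) → Mat (A i)) : piTrace (X * Y) = piTrace (Y * X) := by
  simp only [piTrace_apply, Pi.mul_apply]
  exact Finset.sum_congr rfl fun i _ => Matrix.trace_mul_comm _ _

theorem piTrace_star (X : (i : ι) → Mat (A i)) : piTrace (star X) = star (piTrace X) := by
  simp [piTrace_apply, Matrix.star_eq_conjTranspose, Matrix.trace_conjTranspose]

theorem pi_eq_sum_single [DecidableEq ι] [∀ i, DecidableEq (A i)] (X : (i : ι) → Mat (A i)) :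
    X = ∑ i, ∑ s, ∑ t, X i s t • Pi.single i (Matrix.single s t (1 : ℂ)) := by
  conv_lhs => rw [← Finset.univ_sum_single X]
  refine Finset.sum_congr rfl fun i _ => ?_
  conv_lhs => rw [Matrix.matrix_eq_sum_single (X i)]
  have hs (x : Mat (A i)) : (Pi.single i x : (i : ι) → Mat (A i)) =
    LinearMap.single ℂ (fun i => Mat (A i)) i x := rfl
  simp only [hs, map_sum, ← map_smul]
  simp

theorem exists_piTrace_mul_eq (f : ((i : ι) → Mat (A i)) →ₗ[ℂ] ℂ) :
    ∃ T : (i : ι) → Mat (A i), ∀ X, f X = piTrace (T * X) := by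
  classical
  refine ⟨fun i => Matrix.of fun t s => f (Pi.single i (Matrix.single s t 1)), fun X => ?_⟩
  conv_lhs => rw [pi_eq_sum_single X]
  simp only [map_sum, map_smul, smul_eq_mul, piTrace_apply, Matrix.trace, Matrix.diag,
    Pi.mul_apply, Matrix.mul_apply, Matrix.of_apply]
  refine Finset.sum_congr rfl fun i _ => ?_
  rw [Finset.sum_comm]
  simp_rw [mul_comm]

theorem eq_of_piTrace_mul_eq {X Y : (i : ι) → Mat (A i)}
    (hXY : ∀ a, piTrace (a * X) = piTrace (a * Y)) : X = Y := by
  have h1 : piTrace (star (X - Y) * (X - Y)) = 0 := by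
    rw [mul_sub, map_sub, hXY, sub_self]
  have h2 := (Finset.sum_eq_zero_iff_of_nonneg fun i _ =>
    (Matrix.posSemidef_conjTranspose_mul_self ((X - Y) i)).trace_nonneg).mp h1
  funext i
  exact sub_eq_zero.mp
    (Matrix.trace_conjTranspose_mul_self_eq_zero_iff.mp (h2 i (Finset.mem_univ i)))

theorem eq_zero_of_piTrace_star_mul_mul_nonpos {ρ X : (i : ι) → Mat (A i)}
    (hρ : ∀ i, (ρ i).PosDef) (hX : piTrace (star X * ρ * X) ≤ 0) : X = 0 := by
  classical
  have hpsd (i : ι) : ((X i)ᴴ * ρ i * X i).PosSemidef :=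
    (hρ i).posSemidef.conjTranspose_mul_mul_same (X i)
  have h1 : piTrace (star X * ρ * X) = 0 :=
    le_antisymm hX (Finset.sum_nonneg fun i _ => (hpsd i).trace_nonneg)
  have h0 := (Finset.sum_eq_zero_iff_of_nonneg fun i _ => (hpsd i).trace_nonneg).mp h1
  funext i
  have h2 : (X i)ᴴ * ρ i * X i = 0 := (hpsd i).trace_eq_zero_iff.mp (h0 i (Finset.mem_univ i))
  ext s t
  have h3 := ((hρ i).posSemidef.dotProduct_mulVec_zero_iff (X i *ᵥ Pi.single t 1)).mp (by
    rw [Matrix.star_mulVec, ← Matrix.dotProduct_mulVec, Matrix.mulVec_mulVec, Matrix.mulVec_mulVec, h2]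
    simp)
  have h4 : X i *ᵥ Pi.single t 1 = 0 := by
    by_contra hne
    have := (hρ i).dotProduct_mulVec_pos hne
    rw [h3, dotProduct_zero] at this
    exact lt_irrefl _ this
  simpa using congrFun h4 s

theorem PiIsChannel.piTrace_map
    {E : ((i : ι) → Mat (A i)) →ₗ[ℂ] (j : κ) → Mat (B j)} (hE : PiIsChannel E) (x : (i : ι) → Mat (A i)) :
    piTrace (E x) = piTrace x := hE.2 x

variable [∀ i, DecidableEq (A i)] [∀ j, DecidableEq (B j)]
  {E : ((i : ι) → Mat (A i)) →ₗ[ℂ] (j : κ) → Mat (B j)}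
  {N : ((j : κ) → Mat (B j)) →ₗ[ℂ] (i : ι) → Mat (A i)}

theorem PiIsCP.two_block_nonneg (hE : PiIsCP E) {ρ : (i : ι) → Mat (A i)}
    (hρ : ∀ i, (ρ i).PosSemidef) (C : (i : ι) → Mat (A i)) (D : (j : κ) → Mat (B j)) :
    0 ≤ piTrace (star D * E ρ * D) - piTrace (star D * E (ρ * star C))
      - piTrace (E (C * ρ) * D) + piTrace (E (C * ρ * star C)) := by
  have h := Finset.sum_nonneg fun j (_ : j ∈ Finset.univ) =>
    hE.sum_trace_nonneg (t := Fin 2) hρ ![1, C] ![D, -1] j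
  simp only [Fin.sum_univ_two, Finset.sum_add_distrib] at h
  simp only [← piTrace_apply] at h
  simp at h
  linear_combination h

/-- A left inverse of a channel with invertible image of the unit has the explicit
trace-adjoint `x ↦ E(1)⁻¹ E(x)`. -/
theorem piTrace_mul_leftInverse (hE : PiIsChannel E) (hN : PiIsChannel N)
    (hNE : ∀ x, N (E x) = x) (hpos : ∀ j, (E 1 j).PosDef) {x : (i : ι) → Mat (A i)}
    {J : (j : κ) → Mat (B j)} (hJ : E 1 * J = E x) (Y : (j : κ) → Mat (B j)) :
    piTrace (x * N Y) = piTrace (J * Y) := by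
  obtain ⟨T, hT⟩ := exists_piTrace_mul_eq (piTrace ∘ₗ LinearMap.mulLeft ℂ x ∘ₗ N)
  simp only [LinearMap.comp_apply, LinearMap.mulLeft_apply] at hT
  have hρ : star (E 1) = E 1 := by rw [← hE.1.map_star, star_one]
  have h1 : piTrace (star T * E 1 * T) ≤ piTrace (x * star x) := by
    have h := hN.1.two_block_nonneg (ρ := E 1) (fun j => (hpos j).posSemidef) (star T) x
    have e1 : piTrace (N (star T * E 1) * x) = piTrace (star T * E 1 * T) := by
      rw [piTrace_mul_comm, hT, piTrace_mul_comm]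
    have e2 : piTrace (star x * N (E 1 * T)) = piTrace (star T * E 1 * T) := by
      have e3 : star x * N (E 1 * T) = star (N (star T * E 1) * x) := by
        rw [star_mul, ← hN.1.map_star, star_mul, star_star, hρ]
      rw [e3, piTrace_star, e1, ← piTrace_star]
      simp [star_mul, hρ, mul_assoc]
    rw [star_star, e1, e2, hNE, mul_one, hN.piTrace_map, piTrace_mul_comm (star x)] at h
    linear_combination h
  have h2 : piTrace (star J * E x) ≤ piTrace (x * star x) := by
    have h := hE.1.two_block_nonneg (ρ := 1) (fun j => Matrix.PosSemidef.one) (star x) J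
    have e1 : piTrace (E (star x) * J) = piTrace (star J * E x) := by
      rw [hE.1.map_star, ← hJ, star_mul, hρ, mul_assoc]
    rw [star_star, one_mul, mul_one, e1, mul_assoc, hJ, hE.piTrace_map,
      piTrace_mul_comm (star x)] at h
    linear_combination h
  have h3 : piTrace (star T * E x) = piTrace (x * star x) := by
    have h := hT (E (star x))
    rw [hNE, hE.1.map_star] at h
    have := congrArg star h
    rw [← piTrace_star, ← piTrace_star, star_mul, star_mul, star_star, star_star] at this
    rw [this, piTrace_mul_comm]
  have h4 : T - J = 0 := by
    apply eq_zero_of_piTrace_star_mul_mul_nonpos hpos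
    have h5 : piTrace (star (T - J) * E 1 * (T - J)) = piTrace (star T * E 1 * T)
        - piTrace (star T * E x) - star (piTrace (star T * E x)) + piTrace (star J * E x) := by
      have e1 : star (T - J) * E 1 * (T - J) = star T * E 1 * T - star T * (E 1 * J)
          - star (E 1 * J) * T + star J * (E 1 * J) := by
        rw [star_sub, star_mul, hρ]
        noncomm_ring
      rw [e1, hJ, map_add, map_sub, map_sub, ← piTrace_star, star_mul, star_star]
    have h6 : star (piTrace (x * star x)) = piTrace (x * star x) := by
      rw [← piTrace_star, star_mul, star_star]
    rw [h5, h3, h6]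
    linear_combination h1 + h2
  rw [hT, sub_eq_zero.mp h4]

end

theorem sum_sum_le_card_mul_trace {n : Type} [Fintype n] {Y : Mat n} (hY : Y.PosSemidef) :
    ∑ p, ∑ q, Y p q ≤ Fintype.card n * Y.trace := by
  classical
  have key (p q : n) : 0 ≤ Y p p + Y q q - Y p q - Y q p := by
    have h := hY.dotProduct_mulVec_nonneg (Pi.single p 1 - Pi.single q 1)
    simp [Matrix.mulVec_sub, sub_dotProduct] at h
    linear_combination h
  have h1 := Finset.sum_nonneg fun p (_ : p ∈ Finset.univ) =>
    Finset.sum_nonneg fun q (_ : q ∈ Finset.univ) => key p q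
  simp only [Finset.sum_sub_distrib, Finset.sum_add_distrib, Finset.sum_const, Finset.card_univ,
    nsmul_eq_mul, ← Finset.mul_sum] at h1
  rw [Finset.sum_comm (f := fun p q => Y q p)] at h1
  change 0 ≤ Fintype.card n * Y.trace + Fintype.card n * Y.trace - _ - _ at h1
  linear_combination (1 / 2 : ℂ) * h1

/-- The expectation of a positive semidefinite matrix in the unnormalised maximally entangled
vector is bounded by the dimension times the trace. -/
theorem sum_diagonal_le_card_mul_trace {n : Type} [Fintype n] {X : Mat (n × n)}
    (hX : X.PosSemidef) :
    ∑ p, ∑ q, X (p, p) (q, q) ≤ Fintype.card n * X.trace := by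
  classical
  refine (sum_sum_le_card_mul_trace (hX.submatrix fun p => (p, p))).trans ?_
  gcongr
  simp only [Matrix.trace, Matrix.diag, Matrix.submatrix_apply, Fintype.sum_prod_type]
  exact Finset.sum_le_sum fun p _ => Finset.single_le_sum
    (f := fun q => X (p, q) (p, q)) (fun q _ => hX.diag_nonneg) (Finset.mem_univ p)

theorem sum_reorder_loop {S T H : Type} [Fintype S] [Fintype T] [Fintype H]
    (f : S → S → T → T → H → H → ℂ) :
    ∑ α, ∑ β, ∑ p, ∑ k, ∑ q, ∑ l, f α β p q k l =
      ∑ p, ∑ q, ∑ α, ∑ k, ∑ β, ∑ l, f α β p q k l := by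
  let e : S × S × T × H × T × H ≃ T × T × S × H × S × H :=
    ⟨fun x => (x.2.2.1, x.2.2.2.2.1, x.1, x.2.2.2.1, x.2.1, x.2.2.2.2.2),
      fun x => (x.2.2.1, x.2.2.2.2.1, x.1, x.2.2.2.1, x.2.1, x.2.2.2.2.2),
      fun _ => rfl, fun _ => rfl⟩
  have key := Fintype.sum_equiv e
    (fun x => f x.1 x.2.1 x.2.2.1 x.2.2.2.2.1 x.2.2.2.1 x.2.2.2.2.2)
    (fun x => f x.2.2.1 x.2.2.2.2.1 x.1 x.2.1 x.2.2.2.1 x.2.2.2.2.2) (fun _ => rfl)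
  simpa only [Fintype.sum_prod_type] using key

section

variable {ι κ H : Type} {A : ι → Type} {B : κ → Type}

section

variable [Fintype κ] [Fintype H] [DecidableEq κ] [∀ j, Fintype (B j)]
  {N : ((j : κ) → Mat (B j × H)) →ₗ[ℂ] (i : ι) → Mat (A i)}

/-- `N` applied to the rank-one operator built from two columns of `V`. -/
def columnImage (N : ((j : κ) → Mat (B j × H)) →ₗ[ℂ] (i : ι) → Mat (A i))
    (j : κ) (V : Mat (B j × H)) (u v : B j × H) : (i : ι) → Mat (A i) :=
  N (Pi.single j (Matrix.vecMulVec (fun s => V s u) (star fun s => V s v)))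

theorem map_conj_eq_sum_columnImage (V G : (j : κ) → Mat (B j × H)) :
    N (fun j => V j * G j * (V j)ᴴ) = ∑ j, ∑ u, ∑ v, G j u v • columnImage N j (V j) u v := by
  have h1 (j : κ) : V j * G j * (V j)ᴴ = ∑ u, ∑ v, G j u v •
      Matrix.vecMulVec (fun s => V j s u) (star fun s => V j s v) := by
    ext s t
    simp only [Matrix.mul_apply, Matrix.sum_apply, Matrix.smul_apply, Matrix.vecMulVec_apply,
      Matrix.conjTranspose_apply, Pi.star_apply, smul_eq_mul, Finset.sum_mul]
    rw [Finset.sum_comm]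
    refine Finset.sum_congr rfl fun u _ => Finset.sum_congr rfl fun v _ => by ring
  rw [← Finset.univ_sum_single (fun j => V j * G j * (V j)ᴴ), map_sum]
  refine Finset.sum_congr rfl fun j _ => ?_
  rw [h1]
  change N (LinearMap.single ℂ (fun j => Mat (B j × H)) j _) = _
  simp only [map_sum, map_smul]
  rfl

variable [Fintype ι] [∀ i, Fintype (A i)]
  {M : ((i : ι) → Mat (A i × H)) →ₗ[ℂ] (j : κ) → Mat (B j)}

/-- The loop obtained by feeding `N` into `M` along the vectors given by the columns of `V`. -/
theorem loop_le (hM : PiIsChannel M) (hN : PiIsChannel N) (j : κ) (V : Mat (B j × H)) :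
    ∑ p, ∑ q, M (fun i => Matrix.of fun s t => columnImage N j V (p, s.2) (q, t.2) i s.1 t.1) j p q
      ≤ Fintype.card (B j) * (V * Vᴴ).trace := by
  let Y : (j' : κ) → Mat ((B j × H) × (B j' × H)) := Pi.single j
    (Matrix.vecMulVec (fun x => V x.2 x.1) (star fun x => V x.2 x.1))
  have hY (j' : κ) : (Y j').PosSemidef := by
    by_cases h : j' = j
    · subst h
      simpa [Y] using Matrix.posSemidef_vecMulVec_self_star _
    · simpa [Y, Pi.single_eq_of_ne h] using Matrix.PosSemidef.zero
  have hYtr : ∑ j', (Y j').trace = (V * Vᴴ).trace := by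
    rw [Finset.sum_eq_single j (fun j' _ h => by simp [Y, Pi.single_eq_of_ne h]) (by simp)]
    simp only [Y, Pi.single_eq_same, Matrix.trace, Matrix.diag, Matrix.vecMulVec_apply,
      Matrix.mul_apply, Fintype.sum_prod_type (f := fun x : (B j × H) × (B j × H) => _),
      Pi.star_apply, Matrix.conjTranspose_apply]
    rw [Finset.sum_comm]
  have hcol (u v : B j × H) (i : ι) (x y : A i) :
      piAmplL (B j × H) N Y i (u, x) (v, y) = columnImage N j V u v i x y := by
    have hcast : (fun j' => Matrix.of fun s t => Y j' (u, s) (v, t)) =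
        Pi.single j (Matrix.vecMulVec (fun s => V s u) (star fun s => V s v)) := by
      funext j'
      by_cases h : j' = j
      · subst h
        ext s t
        simp [Y, Matrix.vecMulVec_apply]
      · ext s t
        simp [Y, Pi.single_eq_of_ne h]
    simp only [piAmplL, columnImage, Matrix.of_apply, hcast]
  let Z : (i : ι) → Mat (B j × (A i × H)) := fun i =>
    (piAmplL (B j × H) N Y i).submatrix (fun x => ((x.1, x.2.2), x.2.1))
      (fun x => ((x.1, x.2.2), x.2.1))
  have hZ (i : ι) : (Z i).PosSemidef := (hN.1.piAmplL_posSemidef Y hY i).submatrix _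
  have hZtr : ∑ i, (Z i).trace = (V * Vᴴ).trace := by
    rw [← hYtr, ← hN.sum_trace_piAmplL Y]
    refine Finset.sum_congr rfl fun i _ => ?_
    simp only [Matrix.trace, Matrix.diag, Z, Matrix.submatrix_apply, Fintype.sum_prod_type]
    refine Finset.sum_congr rfl fun p _ => ?_
    rw [Finset.sum_comm]
  have hX := hM.1.piAmplL_posSemidef Z hZ
  calc _ = ∑ p, ∑ q, piAmplL (B j) M Z j (p, p) (q, q) := by
        simp only [← hcol]; rfl
    _ ≤ Fintype.card (B j) * (piAmplL (B j) M Z j).trace := sum_diagonal_le_card_mul_trace (hX j)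
    _ ≤ Fintype.card (B j) * ∑ j', (piAmplL (B j) M Z j').trace := by
        gcongr
        exact Finset.single_le_sum (f := fun j' => (piAmplL (B j) M Z j').trace)
          (fun j' _ => (hX j').trace_nonneg) (Finset.mem_univ j)
    _ = _ := by rw [hM.sum_trace_piAmplL, hZtr]

end

variable [Fintype ι] [Fintype H] [DecidableEq ι] [DecidableEq H] [∀ i, Fintype (A i)]
  [∀ i, DecidableEq (A i)]

/-- The block of the Choi matrix of `M : A ⊗ M_H → B` at the matrix unit `(i, α, β)` of `A`. -/
def choiBlock (M : ((i : ι) → Mat (A i × H)) →ₗ[ℂ] (j : κ) → Mat (B j)) (i : ι) (α β : A i)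
    (j : κ) : Mat (B j × H) :=
  Matrix.of fun u v => M (Pi.single i (Matrix.single (α, u.2) (β, v.2) 1)) j u.1 v.1

theorem map_apply_eq_sum_choiBlock (M : ((i : ι) → Mat (A i × H)) →ₗ[ℂ] (j : κ) → Mat (B j))
    (z : (i : ι) → Mat (A i × H)) (j : κ) (p q : B j) :
    M z j p q = ∑ i, ∑ s, ∑ t, z i s t * choiBlock M i s.1 t.1 j (p, s.2) (q, t.2) := by
  conv_lhs => rw [pi_eq_sum_single z]
  simp [choiBlock, Matrix.sum_apply]

/-- If compressing by `V` between `M` and `N` yields the identity of `A`, then `dim A` is bounded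
by a weighted trace of `V Vᴴ`. -/
theorem dim_le_sum_card_mul_trace [Fintype κ] [DecidableEq κ] [∀ j, Fintype (B j)]
    {M : ((i : ι) → Mat (A i × H)) →ₗ[ℂ] (j : κ) → Mat (B j)}
    {N : ((j : κ) → Mat (B j × H)) →ₗ[ℂ] (i : ι) → Mat (A i)}
    (hM : PiIsChannel M) (hN : PiIsChannel N)
    (V : (j : κ) → Mat (B j × H))
    (hV : ∀ (i : ι) (α β : A i),
      N (fun j => V j * choiBlock M i α β j * (V j)ᴴ) = Pi.single i (Matrix.single α β 1)) :
    ∑ i, (Fintype.card (A i) : ℂ) ^ 2 ≤ ∑ j, Fintype.card (B j) * (V j * (V j)ᴴ).trace := by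
  refine le_trans (le_of_eq ?_) (Finset.sum_le_sum fun j _ => loop_le hM hN j (V j))
  have h1 : ∑ i, (Fintype.card (A i) : ℂ) ^ 2 =
      ∑ i, ∑ α, ∑ β, N (fun j => V j * choiBlock M i α β j * (V j)ᴴ) i α β := by
    simp [hV, sq]
  rw [h1]
  simp only [map_conj_eq_sum_columnImage, map_apply_eq_sum_choiBlock, Finset.sum_apply,
    Matrix.sum_apply, Pi.smul_apply, Matrix.smul_apply, smul_eq_mul, Matrix.of_apply,
    Fintype.sum_prod_type]
  let F (i : ι) (j : κ) (α β : A i) (p q : B j) (k l : H) : ℂ :=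
    choiBlock M i α β j (p, k) (q, l) * columnImage N j (V j) (p, k) (q, l) i α β
  calc _ = ∑ i, ∑ α, ∑ β, ∑ j, ∑ p, ∑ k, ∑ q, ∑ l, F i j α β p q k l := rfl
    _ = ∑ i, ∑ j, ∑ α, ∑ β, ∑ p, ∑ k, ∑ q, ∑ l, F i j α β p q k l := by
        refine Finset.sum_congr rfl fun i _ => ?_
        simp_rw [Finset.sum_comm (s := (Finset.univ : Finset κ))]
    _ = ∑ j, ∑ i, ∑ α, ∑ β, ∑ p, ∑ k, ∑ q, ∑ l, F i j α β p q k l := Finset.sum_comm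
    _ = ∑ j, ∑ i, ∑ p, ∑ q, ∑ α, ∑ k, ∑ β, ∑ l, F i j α β p q k l := by
        refine Finset.sum_congr rfl fun j _ => Finset.sum_congr rfl fun i _ => ?_
        exact sum_reorder_loop _
    _ = ∑ j, ∑ p, ∑ q, ∑ i, ∑ α, ∑ k, ∑ β, ∑ l, F i j α β p q k l := by
        refine Finset.sum_congr rfl fun j _ => ?_
        rw [Finset.sum_comm]
        refine Finset.sum_congr rfl fun p _ => ?_
        rw [Finset.sum_comm]
    _ = _ := by simp only [F, mul_comm]

end

section

variable {m n h : ℕ} {a : Fin m → ℕ} {b : Fin n → ℕ}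

/-- The map `x ↦ (M ⊗ id)(x ⊗ W_ω)`. -/
def encode (M : ((i : Fin m) → Mat (Fin (a i) × Fin h)) →ₗ[ℂ] (j : Fin n) → Mat (Fin (b j)))
    (ω : Mat (Fin h)) :
    ((i : Fin m) → Mat (Fin (a i))) →ₗ[ℂ] (j : Fin n) → Mat (Fin (b j) × Fin h) where
  toFun x := piAmplR (Fin h) M fun i => tensorState (x i) (pureState ω)
  map_add' x y := by
    funext j
    ext p q
    have hsum : (fun i => Matrix.of fun s t =>
          tensorState ((x + y) i) (pureState ω) (s, p.2) (t, q.2)) =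
        (fun i => Matrix.of fun s t => tensorState (x i) (pureState ω) (s, p.2) (t, q.2)) +
        fun i => Matrix.of fun s t => tensorState (y i) (pureState ω) (s, p.2) (t, q.2) := by
      funext i
      ext s t
      simp [tensorState, add_mul]
    exact (congrArg (fun z => M z j p.1 q.1) hsum).trans
      (congrFun₂ (congrFun (M.map_add _ _) j) p.1 q.1)
  map_smul' c x := by
    funext j
    ext p q
    have hsmul : (fun i => Matrix.of fun s t =>
          tensorState ((c • x) i) (pureState ω) (s, p.2) (t, q.2)) =
        c • fun i => Matrix.of fun s t => tensorState (x i) (pureState ω) (s, p.2) (t, q.2) := by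
      funext i
      ext s t
      simp [tensorState, mul_assoc]
    exact (congrArg (fun z => M z j p.1 q.1) hsmul).trans
      (congrFun₂ (congrFun (M.map_smul c _) j) p.1 q.1)

variable {M : ((i : Fin m) → Mat (Fin (a i) × Fin h)) →ₗ[ℂ] (j : Fin n) → Mat (Fin (b j))}
  {ω : Mat (Fin h)}

theorem encode_apply (x : (i : Fin m) → Mat (Fin (a i))) (j : Fin n) (u v : Fin (b j) × Fin h) :
    encode M ω x j u v = M (fun i => Matrix.of fun s t =>
      x i s.1 t.1 * (ω u.2 s.2 * star (ω v.2 t.2))) j u.1 v.1 := rfl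

theorem encode_isChannel (hM : PiIsChannel M) (hω : (ωᴴ * ω).trace = 1) :
    PiIsChannel (encode M ω) := by
  constructor
  · intro k X hX j
    let Z : (i : Fin m) → Mat ((Fin k × Fin h) × (Fin (a i) × Fin h)) := fun i =>
      (X i ⊗ₖ pureState ω).submatrix (fun p => ((p.1.1, p.2.1), (p.2.2, p.1.2)))
        (fun p => ((p.1.1, p.2.1), (p.2.2, p.1.2)))
    have hZ (i : Fin m) : (Z i).PosSemidef :=
      ((hX i).kronecker (Matrix.posSemidef_vecMulVec_self_star _)).submatrix _
    have hMZ : piAmplL (Fin k) (encode M ω) X j = (piAmplL (Fin k × Fin h) M Z j).submatrix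
        (fun p => ((p.1, p.2.2), p.2.1)) (fun p => ((p.1, p.2.2), p.2.1)) := by
      ext p q
      simp only [piAmplL, Matrix.of_apply, encode_apply, Matrix.submatrix_apply, Z,
        Matrix.kroneckerMap_apply, pureState, outer, Matrix.vecMulVec_apply, pureVec, Pi.star_apply]
    rw [hMZ]
    exact (hM.1.piAmplL_posSemidef Z hZ j).submatrix _
  · intro x
    have key (s : Fin h) := hM.2 (fun i => Matrix.of fun p q =>
      x i p.1 q.1 * (ω s p.2 * star (ω s q.2)))
    have hω' : ∑ s, ∑ k, ω s k * star (ω s k) = 1 := by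
      rw [← hω, Finset.sum_comm]
      simp [Matrix.trace, Matrix.mul_apply, mul_comm]
    calc _ = ∑ s, ∑ j, (M (fun i => Matrix.of fun p q =>
          x i p.1 q.1 * (ω s p.2 * star (ω s q.2))) j).trace := by
          simp only [Matrix.trace, Matrix.diag, encode_apply, Fintype.sum_prod_type]
          rw [Finset.sum_comm]
          refine Finset.sum_congr rfl fun j _ => ?_
          rw [Finset.sum_comm]
      _ = (∑ i, (x i).trace) * ∑ s, ∑ k, ω s k * star (ω s k) := by
          rw [Finset.mul_sum]
          refine Finset.sum_congr rfl fun s _ => (key s).trans ?_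
          simp only [Matrix.trace, Matrix.diag, Matrix.of_apply, Fintype.sum_prod_type,
            Finset.sum_mul]
          simp only [Finset.mul_sum]
      _ = _ := by rw [hω', mul_one]

theorem encode_single (i : Fin m) (α β : Fin (a i)) (j : Fin n) :
    encode M ω (Pi.single i (Matrix.single α β 1)) j =
      ((1 : Mat (Fin (b j))) ⊗ₖ ω) * choiBlock M i α β j * ((1 : Mat (Fin (b j))) ⊗ₖ ω)ᴴ := by
  ext u v
  rw [encode_apply, map_apply_eq_sum_choiBlock,
    Finset.sum_eq_single i (fun i' _ h => by simp [Pi.single_eq_of_ne h]) (by simp)]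
  simp only [Pi.single_eq_same, Fintype.sum_prod_type, Matrix.of_apply, Matrix.single_apply,
    Matrix.mul_apply,
    Matrix.conjTranspose_apply, Matrix.kroneckerMap_apply, Matrix.one_apply, ite_and, ite_mul,
    one_mul, zero_mul, Finset.sum_ite_eq, Finset.sum_ite_irrel, Finset.sum_const_zero,
    Finset.mem_univ, if_true, Finset.sum_mul, mul_ite, apply_ite star, star_zero, mul_zero]
  rw [Finset.sum_comm]
  refine Finset.sum_congr rfl fun l _ => Finset.sum_congr rfl fun k _ => by ring

theorem encode_one_posDef (hb : ∀ j, 1 ≤ b j) (hdim : ∑ i, (a i) ^ 2 = ∑ j, (b j) ^ 2)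
    (hωinv : IsUnit ω) (hω : (ωᴴ * ω).trace = 1) (hM : PiIsChannel M)
    {N : ((j : Fin n) → Mat (Fin (b j) × Fin h)) →ₗ[ℂ] (i : Fin m) → Mat (Fin (a i))}
    (hN : PiIsChannel N) (hNE : ∀ x, N (encode M ω x) = x) (j : Fin n) :
    (encode M ω 1 j).PosDef := by
  have hE := encode_isChannel hM hω
  have hpsd := hE.1.posSemidef (ρ := 1) (fun i => Matrix.PosSemidef.one) j
  by_contra hnot
  obtain ⟨ψ, hψ0, hψ⟩ : ∃ ψ, ψ ≠ 0 ∧ encode M ω 1 j *ᵥ ψ = 0 := by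
    by_contra! hne
    refine hnot (Matrix.PosDef.of_dotProduct_mulVec_pos hpsd.1 fun x hx => ?_)
    refine lt_of_le_of_ne (hpsd.dotProduct_mulVec_nonneg x) fun h0 => ?_
    exact hne x hx ((hpsd.dotProduct_mulVec_zero_iff x).mp h0.symm)
  have hker := hE.1.mulVec_eq_zero hψ
  have hψψ : 0 < star ψ ⬝ᵥ ψ := dotProduct_star_self_pos_iff.mpr hψ0
  set c : ℂ := (star ψ ⬝ᵥ ψ)⁻¹ with hc
  let K : (j : Fin n) → Mat (Fin (b j) × Fin h) := fun j => (1 : Mat (Fin (b j))) ⊗ₖ ω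
  -- the projection onto the orthogonal complement of `ψ`
  let Q : Mat (Fin (b j) × Fin h) := 1 - c • Matrix.vecMulVec ψ (star ψ)
  let P : (j : Fin n) → Mat (Fin (b j) × Fin h) := Function.update 1 j Q
  have hcpos : 0 < c := by
    rw [hc]
    exact inv_pos.mpr hψψ
  have hQh : Qᴴ = Q := by
    have hcs : star c = c := (hcpos.le.isSelfAdjoint)
    simp [Q, Matrix.conjTranspose_sub, Matrix.conjTranspose_smul, hcs,
      Matrix.conjTranspose_vecMulVec]
  have hQψ : Q *ᵥ ψ = 0 := by
    have : c * (star ψ ⬝ᵥ ψ) = 1 := inv_mul_cancel₀ hψψ.ne'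
    simp [Q, Matrix.sub_mulVec, Matrix.smul_mulVec, Matrix.vecMulVec_mulVec, smul_smul, this]
  have hmulQ {X : Mat (Fin (b j) × Fin h)} (hX : X *ᵥ ψ = 0) : X * Q = X := by
    simp [Q, Matrix.mul_sub, Matrix.mul_vecMulVec, hX]
  have hQQ : Q * Q = Q := hmulQ hQψ
  have hEQ (x) : encode M ω x j * Q = encode M ω x j := hmulQ (hker x)
  have hQE (x) : Q * encode M ω x j = encode M ω x j := by
    have h1 := congrArg Matrix.conjTranspose (hEQ (star x))
    rw [hE.1.map_star] at h1
    simpa [Matrix.conjTranspose_mul, hQh, Matrix.star_eq_conjTranspose] using h1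
  have hcount := dim_le_sum_card_mul_trace hM hN (fun j => P j * K j) (fun i α β => by
    rw [← hNE (Pi.single i (Matrix.single α β 1))]
    congr 1
    funext j'
    have hconj : P j' * K j' * choiBlock M i α β j' * (P j' * K j')ᴴ =
        P j' * encode M ω (Pi.single i (Matrix.single α β 1)) j' * (P j')ᴴ := by
      rw [encode_single]
      simp only [K, Matrix.conjTranspose_mul, Matrix.mul_assoc]
    rw [hconj]
    by_cases hj : j' = j
    · subst hj
      simp only [P, Function.update_self, hQh, hQE, hEQ]
    · simp [P, Function.update_of_ne hj])
  have htr (j' : Fin n) : (K j' * (K j')ᴴ).trace = b j' := by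
    rw [Matrix.conjTranspose_kronecker, ← Matrix.mul_kronecker_mul, Matrix.trace_kronecker,
      Matrix.trace_mul_comm ω, hω]
    simp
  have htrQ : (Q * K j * (Q * K j)ᴴ).trace < b j := by
    obtain ⟨ν, hν⟩ := hωinv.exists_right_inv
    have hKψ : (K j)ᴴ *ᵥ ψ ≠ 0 := fun h0 => hψ0 (by
      have h1 : ((1 : Mat (Fin (b j))) ⊗ₖ νᴴ) * (K j)ᴴ = 1 := by
        rw [Matrix.conjTranspose_kronecker, ← Matrix.mul_kronecker_mul,
          ← Matrix.conjTranspose_mul, hν]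
        simp
      rw [← Matrix.one_mulVec ψ, ← h1, ← Matrix.mulVec_mulVec, h0, Matrix.mulVec_zero])
    have hpos : 0 < star ψ ⬝ᵥ ((K j * (K j)ᴴ) *ᵥ ψ) := by
      have := dotProduct_star_self_pos_iff.mpr hKψ
      rwa [Matrix.star_mulVec, Matrix.conjTranspose_conjTranspose, ← Matrix.dotProduct_mulVec,
        Matrix.mulVec_mulVec] at this
    have hexp : (Q * K j * (Q * K j)ᴴ).trace =
        (K j * (K j)ᴴ).trace - c * (star ψ ⬝ᵥ ((K j * (K j)ᴴ) *ᵥ ψ)) := by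
      calc _ = (Q * (K j * (K j)ᴴ) * Q).trace := by
            simp only [Matrix.conjTranspose_mul, hQh, Matrix.mul_assoc]
        _ = (K j * (K j)ᴴ * Q).trace := by
            rw [Matrix.trace_mul_comm, ← Matrix.mul_assoc, hQQ, Matrix.trace_mul_comm]
        _ = _ := by
            simp only [Q, Matrix.mul_sub, Matrix.mul_one, Matrix.mul_smul, Matrix.mul_vecMulVec,
              Matrix.trace_sub, Matrix.trace_smul, Matrix.trace_vecMulVec, smul_eq_mul]
            rw [dotProduct_comm]
    rw [hexp, htr]
    exact sub_lt_self _ (mul_pos hcpos hpos)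
  refine absurd hcount (not_le_of_gt ?_)
  have hdim' : ∑ i, (Fintype.card (Fin (a i)) : ℂ) ^ 2 = ∑ j, (b j : ℂ) * b j := by
    simp only [Fintype.card_fin, ← sq]
    exact_mod_cast hdim
  rw [hdim']
  refine Finset.sum_lt_sum (fun j' _ => ?_) ⟨j, Finset.mem_univ j, ?_⟩
  · by_cases hj : j' = j
    · subst hj
      simp only [P, Function.update_self, Fintype.card_fin]
      gcongr
    · simp [P, Function.update_of_ne hj, htr]
  · have hbj : (0 : ℂ) < b j := by exact_mod_cast hb j
    simp only [P, Function.update_self, Fintype.card_fin]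
    exact mul_lt_mul_of_pos_left htrQ hbj

end

/-- **Uniqueness of the entanglement-left inverse in the equal-dimension case.**
If `dim A = dim B` and `M : A ⊗ M_h(ℂ) → B` is entanglement-reversible with
respect to the pure state defined by an invertible, normalised `ω ∈ M_h(ℂ)`, then
any two entanglement-left inverses of `M` coincide. -/
theorem entanglement_left_inverse_unique
    {m n : ℕ} (a : Fin m → ℕ) (b : Fin n → ℕ)
    (ha : ∀ i, 1 ≤ a i) (hb : ∀ j, 1 ≤ b j)
    (hdim : ∑ i, (a i) ^ 2 = ∑ j, (b j) ^ 2)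
    (h : ℕ) (hh : 1 ≤ h)
    (ω : Mat (Fin h)) (hωinv : IsUnit ω) (hωtr : (ωᴴ * ω).trace = 1)
    (M : ((i : Fin m) → Mat (Fin (a i) × Fin h)) →ₗ[ℂ] (j : Fin n) → Mat (Fin (b j)))
    (hM : PiIsChannel M) (hrev : PiEntReversible M (pureState ω))
    (N N' : ((j : Fin n) → Mat (Fin (b j) × Fin h)) →ₗ[ℂ] (i : Fin m) → Mat (Fin (a i)))
    (hN : PiIsChannel N) (hN' : PiIsChannel N')
    (hNli : PiEntLeftInv M N (pureState ω)) (hN'li : PiEntLeftInv M N' (pureState ω)) :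
    N = N' := by
  have hE := encode_isChannel hM hωtr
  have hpos := encode_one_posDef hb hdim hωinv hωtr hM hN hNli
  refine LinearMap.ext fun Y => eq_of_piTrace_mul_eq fun x => ?_
  have hJ : encode M ω 1 * (fun j => (encode M ω 1 j)⁻¹ * encode M ω x j) = encode M ω x := by
    funext j
    exact Matrix.mul_nonsing_inv_cancel_left _ _
      ((Matrix.isUnit_iff_isUnit_det _).mp (hpos j).isUnit)
  rw [piTrace_mul_leftInverse hE hN hNli hpos hJ, piTrace_mul_leftInverse hE hN' hN'li hpos hJ]

end EntInvPaper
end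
end
end
end

section
/- Entanglement-invertibility with respect to a pure state with invertible ω implies entanglement-invertibility with respect to the canonical maximally entangled state. Let A and B be multimatrix algebras, let h ≥ 1, let ω ∈ M_h(ℂ) be invertible with Tr(ω†ω) = 1, and let W_ω := |w_ω⟩⟨w_ω| with w_ω := ∑_{k<h} e_k⊗ω e_k. If a channel M : A⊗M_h(ℂ) → B is entanglement-invertible with respect to W_ω, then M is also entanglement-invertible with respect to the canonical maximally entangled state |Ω_h⟩⟨Ω_h|, where Ω_h := (1/√h)∑_{k<h} e_k⊗e_k. -/
noncomputable section

open Matrix Kronecker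
open scoped ComplexOrder

noncomputable section

open Matrix Kronecker
open scoped ComplexOrder

noncomputable section
open Matrix Kronecker
open scoped ComplexOrder
namespace EntInvPaper

section Kraus

variable {ι κ : Type} [Fintype ι] {A : ι → Type} {B : κ → Type}
  [∀ i, Fintype (A i)] {E : ι → κ → Type} [∀ i j, Fintype (E i j)]

/-- The map between multimatrix algebras with Kraus operators `V i j s` from block `i`
to block `j`. -/
def krausMap (V : ∀ i j, E i j → Matrix (B j) (A i) ℂ) :
    ((i : ι) → Mat (A i)) →ₗ[ℂ] (j : κ) → Mat (B j) where
  toFun x j := ∑ i, ∑ s, V i j s * x i * (V i j s)ᴴ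
  map_add' x y := by
    funext j
    simp [Matrix.mul_add, Matrix.add_mul, Finset.sum_add_distrib]
  map_smul' c x := by
    funext j
    simp [Finset.smul_sum]

theorem krausMap_apply (V : ∀ i j, E i j → Matrix (B j) (A i) ℂ) (x : (i : ι) → Mat (A i))
    (j : κ) : krausMap V x j = ∑ i, ∑ s, V i j s * x i * (V i j s)ᴴ := rfl

theorem krausMap_piIsCP [∀ j, Fintype (B j)] (V : ∀ i j, E i j → Matrix (B j) (A i) ℂ) :
    PiIsCP (krausMap V) := by
  intro k X hX j
  have key : piAmplL (Fin k) (krausMap V) X j =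
      ∑ i, ∑ s, ((1 : Mat (Fin k)) ⊗ₖ V i j s) * X i * ((1 : Mat (Fin k)) ⊗ₖ V i j s)ᴴ := by
    ext p q
    simp [piAmplL, krausMap_apply, Matrix.sum_apply, Matrix.mul_apply, Fintype.sum_prod_type,
      Matrix.one_apply, ite_mul, Finset.sum_ite_eq, apply_ite (starRingEnd ℂ)]
  rw [key]
  exact posSemidef_sum _ fun i _ => posSemidef_sum _ fun s _ =>
    (hX i).mul_mul_conjTranspose_same _

theorem PiIsCP.exists_krausMap [∀ j, Fintype (B j)]
    {Φ : ((i : ι) → Mat (A i)) →ₗ[ℂ] (j : κ) → Mat (B j)}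
    (hΦ : PiIsCP Φ) :
    ∃ (e : ι → κ → ℕ) (V : ∀ i j, Fin (e i j) → Matrix (B j) (A i) ℂ), Φ = krausMap V := by
  classical
  have choi : ∀ i j, ∃ (r : ℕ) (V : Fin r → Matrix (B j) (A i) ℂ), ∀ α α' β β',
      Φ (Pi.single i (Matrix.single α α' 1)) j β β' = ∑ s, V s β α * star (V s β' α') := by
    intro i j
    let ε := (Fintype.equivFin (A i)).symm
    let d : Fin (Fintype.card (A i)) × A i → ℂ := fun p => if ε p.1 = p.2 then 1 else 0
    have hpos := hΦ _ (Pi.single i (vecMulVec d (star d))) (fun i' => by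
      by_cases hi : i' = i
      · subst hi
        simpa using posSemidef_vecMulVec_self_star d
      · simpa [hi] using PosSemidef.zero) j
    obtain ⟨r, v, hv⟩ := posSemidef_iff_eq_sum_vecMulVec.mp hpos
    refine ⟨r, fun s => Matrix.of fun β α => v s (ε.symm α, β), fun α α' β β' => ?_⟩
    have hentry := congrFun (congrFun hv (ε.symm α, β)) (ε.symm α', β')
    simp only [Matrix.sum_apply, vecMulVec_apply, Pi.star_apply] at hentry
    simp only [of_apply, ← hentry, piAmplL]
    refine congrArg (fun z => Φ z j β β') (funext fun i' => ?_)
    by_cases hi : i' = i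
    · subst hi
      ext x y
      simp [d, vecMulVec_apply, Matrix.single_apply, ite_and]
      split_ifs <;> rfl
    · simp [hi]
      rfl
  choose e V hV using choi
  refine ⟨e, V, LinearMap.ext fun x => ?_⟩
  have hx : x = ∑ i, ∑ α, ∑ α', x i α α' • Pi.single i (Matrix.single α α' (1 : ℂ)) := by
    funext i
    ext α α'
    have : ∀ i', (∑ α, ∑ α', x i' α α' •
        (Pi.single i' (Matrix.single α α' (1 : ℂ)) : (i : ι) → Mat (A i))) =
        Pi.single i' (x i') := by
      intro i'
      conv_rhs => rw [Matrix.matrix_eq_sum_single (x i')]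
      rw [← LinearMap.coe_single ℂ]
      simp only [map_sum, ← map_smul]
      simp
    simp only [this, Finset.univ_sum_single]
  funext j
  ext β β'
  conv_lhs => rw [hx]
  simp only [map_sum, map_smul, Finset.sum_apply, Pi.smul_apply, Matrix.sum_apply,
    Matrix.smul_apply, hV, krausMap_apply, Matrix.mul_apply, conjTranspose_apply, smul_eq_mul,
    Finset.mul_sum, Finset.sum_mul]
  refine Finset.sum_congr rfl fun i _ => ?_
  rw [Finset.sum_comm, Finset.sum_comm (s := (Finset.univ : Finset (Fin (e i j))))]
  refine Finset.sum_congr rfl fun α' _ => ?_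
  rw [Finset.sum_comm]
  refine Finset.sum_congr rfl fun s _ => Finset.sum_congr rfl fun α _ => ?_
  ring

theorem krausMap_tracePreserving_iff [Fintype κ] [∀ j, Fintype (B j)]
    [∀ i, DecidableEq (A i)]
    (V : ∀ i j, E i j → Matrix (B j) (A i) ℂ) :
    (∀ x, ∑ j, (krausMap V x j).trace = ∑ i, (x i).trace) ↔
      ∀ i, ∑ j, ∑ s, (V i j s)ᴴ * V i j s = 1 := by
  classical
  have key : ∀ x, ∑ j, (krausMap V x j).trace =
      ∑ i, ((∑ j, ∑ s, (V i j s)ᴴ * V i j s) * x i).trace := by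
    intro x
    simp only [krausMap_apply, Matrix.trace_sum, Finset.sum_mul]
    rw [Finset.sum_comm]
    refine Finset.sum_congr rfl fun i _ => Finset.sum_congr rfl fun j _ =>
      Finset.sum_congr rfl fun s _ => ?_
    rw [Matrix.trace_mul_comm, Matrix.mul_assoc]
  simp only [key]
  constructor
  · intro h i
    rw [ext_iff_trace_mul_right]
    intro y
    have := h (Pi.single i y)
    rw [Finset.sum_eq_single i, Finset.sum_eq_single i] at this
    · simpa using this
    all_goals simp +contextual
  · intro h x
    simp [h]

end Kraus

section Attach

variable {ι κ : Type} [Fintype ι] {A : ι → Type} {B : κ → Type}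
  [∀ i, Fintype (A i)] {E : ι → κ → Type} [∀ i j, Fintype (E i j)]
  {h₁ h₂ : Type}

/-- The operator `(V ⊗ 1)(1 ⊗ w_ω)` obtained by feeding one half of `w_ω` into `V`. -/
def attach [Fintype h₁] {p q : Type} (ω : Matrix h₂ h₁ ℂ) (V : Matrix q (p × h₁) ℂ) :
    Matrix (q × h₂) p ℂ :=
  Matrix.of fun y x => ∑ k, ω y.2 k * V y.1 (x, k)

theorem piAmplR_krausMap_pureState [Fintype h₁] (V : ∀ i j, E i j → Matrix (B j) (A i × h₁) ℂ)
    (ω : Matrix h₂ h₁ ℂ) (x : (i : ι) → Mat (A i)) (j : κ) :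
    piAmplR h₂ (krausMap V) (fun i => tensorState (x i) (pureState ω)) j =
      ∑ i, ∑ s, attach ω (V i j s) * x i * (attach ω (V i j s))ᴴ := by
  ext p q
  simp only [piAmplR, krausMap_apply, of_apply, Matrix.sum_apply]
  refine Finset.sum_congr rfl fun i _ => Finset.sum_congr rfl fun s _ => ?_
  simp only [Matrix.mul_apply, Fintype.sum_prod_type, conjTranspose_apply, attach, tensorState,
    pureState, outer, pureVec, of_apply, reindex_apply, submatrix_apply, Equiv.symm_symm,
    Equiv.prodAssoc_apply, kroneckerMap_apply, vecMulVec_apply, Pi.star_apply, star_sum,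
    StarMul.star_mul, Finset.sum_mul, Finset.mul_sum]
  refine Finset.sum_congr rfl fun α' _ => ?_
  refine Finset.sum_congr rfl fun k' _ => Finset.sum_congr rfl fun α _ =>
    Finset.sum_congr rfl fun k _ => ?_
  ring

theorem krausMap_piAmplR_krausMap [Fintype κ] [∀ j, Fintype (B j)] [Fintype h₁] [Fintype h₂]
    {F : κ → ι → Type} [∀ j i, Fintype (F j i)]
    (V : ∀ i j, E i j → Matrix (B j) (A i × h₁) ℂ)
    (U : ∀ j i, F j i → Matrix (A i) (B j × h₂) ℂ)
    (ω : Matrix h₂ h₁ ℂ) (x : (i : ι) → Mat (A i)) (i' : ι) :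
    krausMap U (piAmplR h₂ (krausMap V) fun i => tensorState (x i) (pureState ω)) i' =
      ∑ j, ∑ t, ∑ i, ∑ s, (U j i' t * attach ω (V i j s)) * x i *
        (U j i' t * attach ω (V i j s))ᴴ := by
  simp only [krausMap_apply, piAmplR_krausMap_pureState, Matrix.sum_mul, Matrix.mul_sum,
    conjTranspose_mul, Matrix.mul_assoc]

theorem swapState_pureState (ω : Matrix h₂ h₁ ℂ) : swapState (pureState ω) = pureState ωᵀ := rfl

theorem sum_trace_piAmplR [Fintype κ] [∀ j, Fintype (B j)] [Fintype h₂]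
    {Φ : ((i : ι) → Mat (A i)) →ₗ[ℂ] (j : κ) → Mat (B j)}
    (hΦ : ∀ x, ∑ j, (Φ x j).trace = ∑ i, (x i).trace) (X : (i : ι) → Mat (A i × h₂)) :
    ∑ j, (piAmplR h₂ Φ X j).trace = ∑ i, (X i).trace := by
  simp only [Matrix.trace, diag_apply, piAmplR, of_apply, Fintype.sum_prod_type] at hΦ ⊢
  have := fun l : h₂ => hΦ fun i => Matrix.of fun x y => X i (x, l) (y, l)
  simp only [of_apply] at this
  calc _ = ∑ l, ∑ j, ∑ p, Φ (fun i => Matrix.of fun x y => X i (x, l) (y, l)) j p p := by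
        rw [Finset.sum_comm]
        exact Finset.sum_congr rfl fun j _ => Finset.sum_comm
    _ = ∑ l, ∑ i, ∑ p, X i (p, l) (p, l) := by simp only [this]
    _ = _ := by
        rw [Finset.sum_comm]
        exact Finset.sum_congr rfl fun i _ => Finset.sum_comm

theorem trace_tensorState {p : Type} [Fintype p] [Fintype h₁] [Fintype h₂] (x : Mat p)
    (W : Mat (h₁ × h₂)) :
    (tensorState x W).trace = x.trace * W.trace := by
  rw [← Matrix.trace_kronecker]
  exact Fintype.sum_equiv (Equiv.prodAssoc _ _ _) _ _ fun _ => rfl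

end Attach

section Rigidity

theorem sum_conj_single_apply {R p q : Type} [Fintype R] [Fintype q] [DecidableEq q]
    (K : R → Matrix p q ℂ) (α β : q) (α' β' : p) :
    (∑ r, K r * Matrix.single α β (1 : ℂ) * (K r)ᴴ) α' β' = ∑ r, K r α' α * star (K r β' β) := by
  simp [Matrix.sum_apply, Matrix.mul_apply, Matrix.single_apply, ite_and, Finset.sum_ite_eq]

theorem eq_zero_of_sum_mul_star_self {R : Type} [Fintype R] {f : R → ℂ}
    (hf : ∑ r, f r * star (f r) = 0) (r : R) : f r = 0 := by
  have h0 := (Finset.sum_eq_zero_iff_of_nonneg fun r _ => mul_star_self_nonneg (f r)).mp hf r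
    (Finset.mem_univ r)
  simpa using h0

/-- The Kraus operators of the zero map vanish. -/
theorem kraus_eq_zero {R p q : Type} [Fintype R] [Fintype q]
    {K : R → Matrix p q ℂ} (hK : ∀ x : Matrix q q ℂ, ∑ r, K r * x * (K r)ᴴ = 0) (r : R) : K r = 0 := by
  classical
  ext α' α
  refine eq_zero_of_sum_mul_star_self (f := fun r => K r α' α) ?_ r
  rw [← sum_conj_single_apply, hK]
  rfl

/-- The Kraus operators of the identity map are scalars. -/
theorem kraus_eq_smul_one {R p : Type} [Fintype R] [Fintype p] [DecidableEq p]
    {K : R → Matrix p p ℂ} (hK : ∀ x : Matrix p p ℂ, ∑ r, K r * x * (K r)ᴴ = x) (r : R) :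
    ∃ c : ℂ, K r = c • 1 := by
  have entry : ∀ α β α' β', ∑ r, K r α' α * star (K r β' β) = Matrix.single α β (1 : ℂ) α' β' :=
    fun α β α' β' => by rw [← sum_conj_single_apply, hK]
  have off : ∀ α α', α' ≠ α → K r α' α = 0 := fun α α' hne =>
    eq_zero_of_sum_mul_star_self (f := fun r => K r α' α)
      (by rw [entry]; simp [hne.symm]) r
  have diag : ∀ α β, K r α α = K r β β := by
    intro α β
    rw [← sub_eq_zero]
    refine eq_zero_of_sum_mul_star_self (f := fun r => K r α α - K r β β) ?_ r
    simp only [star_sub, sub_mul, mul_sub, Finset.sum_sub_distrib, entry]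
    simp
  rcases isEmpty_or_nonempty p with hp | ⟨⟨α₀⟩⟩
  · exact ⟨0, Subsingleton.elim _ _⟩
  · refine ⟨K r α₀ α₀, ?_⟩
    ext α β
    rcases eq_or_ne α β with rfl | hne
    · simpa using diag α α₀
    · simp [hne, off β α hne]

end Rigidity

section Polynomial

open Polynomial

/-- The unitary polar factor of an invertible `ω` is a polynomial in `ωω†` times `ω`. -/
theorem exists_polynomial_polar {d : Type} [Fintype d] [DecidableEq d] {ω : Mat d}
    (hω : IsUnit ω) :
    ∃ q : ℝ[X], (aeval (ω * ωᴴ) q * ω)ᴴ * (aeval (ω * ωᴴ) q * ω) = 1 := by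
  have hpd : (ω * ωᴴ).PosDef := by
    have := (PosDef.one (n := d) (R := ℂ)).mul_mul_conjTranspose_same (B := ω)
      (Matrix.vecMul_injective_of_isUnit hω)
    simpa using this
  have hsa : IsSelfAdjoint (ω * ωᴴ) := hpd.isHermitian
  have hspec : ∀ x ∈ spectrum ℝ (ω * ωᴴ), 0 < x := by
    intro x hx
    obtain ⟨i, rfl⟩ := hpd.isHermitian.spectrum_real_eq_range_eigenvalues ▸ hx
    exact hpd.eigenvalues_pos i
  obtain ⟨q, hq⟩ := (Polynomial.exists_eval_eq_iff
    (fun x : spectrum ℝ (ω * ωᴴ) => (x : ℝ)) fun x => (Real.sqrt x)⁻¹).mpr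
    fun x y hxy => by simp only [hxy]
  refine ⟨q, ?_⟩
  have hP : aeval (ω * ωᴴ) q = cfc q.eval (ω * ωᴴ) := (cfc_polynomial q _ hsa).symm
  have hPsa : (aeval (ω * ωᴴ) q)ᴴ = aeval (ω * ωᴴ) q := by
    rw [hP]
    exact cfc_predicate q.eval (ω * ωᴴ)
  have hone : aeval (ω * ωᴴ) q * (ω * ωᴴ) * aeval (ω * ωᴴ) q = 1 := by
    have : aeval (ω * ωᴴ) q * (ω * ωᴴ) * aeval (ω * ωᴴ) q = aeval (ω * ωᴴ) (q * X * q) := by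
      simp
    rw [this, ← cfc_polynomial _ _ hsa, ← cfc_one ℝ (ω * ωᴴ)]
    refine cfc_congr fun x hx => ?_
    have hx0 := hspec x hx
    have hqx : q.eval x = (Real.sqrt x)⁻¹ := hq ⟨x, hx⟩
    have hs : Real.sqrt x ≠ 0 := (Real.sqrt_pos.mpr hx0).ne'
    simp only [eval_mul, eval_X, hqx, Pi.one_apply]
    field_simp
    exact (Real.sq_sqrt hx0.le).symm
  rw [mul_eq_one_comm, conjTranspose_mul, hPsa]
  simpa only [Matrix.mul_assoc] using hone

/-- An intertwining relation `U_t (1 ⊗ G) = ∑ₛ Q_{ts} U_s` passes to polynomials. -/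
theorem intertwine_aeval {F p q d : Type} [Fintype F] [DecidableEq F] [Fintype q]
    [DecidableEq q] [Fintype d] [DecidableEq d] {U : F → Matrix p (q × d) ℂ} {G : Mat d}
    {Q : Mat F} (hG : ∀ t, U t * ((1 : Mat q) ⊗ₖ G) = ∑ t', Q t t' • U t') (f : ℝ[X]) (t : F) :
    U t * ((1 : Mat q) ⊗ₖ aeval G f) = ∑ t', (aeval Q f) t t' • U t' := by
  induction f using Polynomial.induction_on generalizing t with
  | C r =>
    simp [Algebra.algebraMap_eq_smul_one, Matrix.one_apply, kronecker_smul]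
  | add f g hf hg =>
    simp [kronecker_add, Matrix.mul_add, hf, hg, add_smul, Finset.sum_add_distrib]
  | monomial n r ih =>
    have hsplit : (C r * X ^ (n + 1) : ℝ[X]) = C r * X ^ n * X := by ring
    rw [hsplit, map_mul, map_mul (aeval Q), aeval_X, aeval_X]
    have : (1 : Mat q) ⊗ₖ (aeval G (C r * X ^ n) * G) =
        ((1 : Mat q) ⊗ₖ aeval G (C r * X ^ n)) * ((1 : Mat q) ⊗ₖ G) := by
      rw [← mul_kronecker_mul, Matrix.one_mul]
    rw [this, ← Matrix.mul_assoc, ih, Matrix.sum_mul]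
    simp only [Matrix.smul_mul, hG, Finset.smul_sum, smul_smul, Matrix.mul_apply,
      Finset.sum_smul]
    exact Finset.sum_comm

end Polynomial

section AttachAlgebra

variable {p q h₁ h₂ h₃ : Type} [Fintype h₁]

theorem kronecker_mul_attach [Fintype h₂] [Fintype q] [DecidableEq q] (P : Matrix h₃ h₂ ℂ)
    (ω : Matrix h₂ h₁ ℂ) (V : Matrix q (p × h₁) ℂ) :
    ((1 : Mat q) ⊗ₖ P) * attach ω V = attach (P * ω) V := by
  ext y x
  simp only [Matrix.mul_apply, attach, of_apply, Fintype.sum_prod_type, kroneckerMap_apply,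
    Matrix.one_apply, ite_mul, one_mul, zero_mul, Finset.mul_sum, Finset.sum_mul]
  rw [Finset.sum_eq_single y.1 (by simp +contextual [eq_comm]) (by simp), Finset.sum_comm]
  simp [mul_assoc]

theorem attach_mul_kronecker [Fintype h₂] [Fintype p] [DecidableEq p] (ω : Matrix h₃ h₂ ℂ)
    (U : Matrix q (p × h₁) ℂ) (P : Matrix h₁ h₂ ℂ) :
    attach ω (U * ((1 : Mat p) ⊗ₖ P)) = attach (ω * Pᵀ) U := by
  ext y x
  simp only [Matrix.mul_apply, attach, of_apply, Fintype.sum_prod_type, kroneckerMap_apply,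
    Matrix.one_apply, ite_mul, one_mul, zero_mul, Finset.mul_sum, Finset.sum_mul,
    transpose_apply]
  rw [Finset.sum_comm, Finset.sum_eq_single x (by simp +contextual) (by simp), Finset.sum_comm]
  refine Finset.sum_congr rfl fun l _ => Finset.sum_congr rfl fun k _ => ?_
  rw [if_pos rfl]
  ring

theorem attach_sum_smul {T : Type} [Fintype T] (ω : Matrix h₂ h₁ ℂ) (c : T → ℂ)
    (V : T → Matrix q (p × h₁) ℂ) :
    attach ω (∑ t, c t • V t) = ∑ t, c t • attach ω (V t) := by
  ext y x
  simp only [attach, of_apply, Matrix.sum_apply, Matrix.smul_apply, smul_eq_mul, Finset.mul_sum]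
  rw [Finset.sum_comm]
  refine Finset.sum_congr rfl fun t _ => Finset.sum_congr rfl fun k _ => ?_
  ring

theorem attach_conjTranspose_attach [Fintype h₂] [Fintype q] [DecidableEq q] (ω : Matrix h₂ h₁ ℂ)
    (U : Matrix p (q × h₂) ℂ) :
    (attach ω (attach ωᵀ U)ᴴ)ᴴ = U * ((1 : Mat q) ⊗ₖ (ω * ωᴴ)) := by
  ext x y
  simp only [Matrix.mul_apply, attach, of_apply, Fintype.sum_prod_type, kroneckerMap_apply,
    Matrix.one_apply, ite_mul, one_mul, zero_mul, conjTranspose_apply, star_sum,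
    StarMul.star_mul, star_star, transpose_apply, Finset.mul_sum, mul_ite,
    mul_zero]
  rw [Finset.sum_comm, Finset.sum_eq_single y.1 (by simp +contextual) (by simp)]
  refine Finset.sum_congr rfl fun l _ => Finset.sum_congr rfl fun k _ => ?_
  rw [if_pos rfl]
  ring

end AttachAlgebra

section Inverse

variable {ι κ : Type} [Fintype ι] {A : ι → Type} {B : κ → Type}
  [∀ i, Fintype (A i)] [∀ j, Fintype (B j)] [∀ i, DecidableEq (A i)]
  {E : ι → κ → Type} {F : κ → ι → Type} [∀ j i, Fintype (F j i)]
  {h₁ h₂ : Type} [Fintype h₁] [Fintype h₂]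

/-- The Kraus operators `U (V ⊗ 1)(1 ⊗ w_ω)` of the composite of two channels through `w_ω`
act as scalars on each block and do not mix different blocks. -/
def IsBlockScalar (V : ∀ i j, E i j → Matrix (B j) (A i × h₁) ℂ)
    (U : ∀ j i, F j i → Matrix (A i) (B j × h₂) ℂ) (ω : Matrix h₂ h₁ ℂ) : Prop :=
  (∀ j i t s, ∃ c : ℂ, U j i t * attach ω (V i j s) = c • 1) ∧
    ∀ j i i' t s, i' ≠ i → U j i' t * attach ω (V i j s) = 0

theorem isBlockScalar_of_inverse [Fintype κ] [∀ i j, Fintype (E i j)]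
    {V : ∀ i j, E i j → Matrix (B j) (A i × h₁) ℂ}
    {U : ∀ j i, F j i → Matrix (A i) (B j × h₂) ℂ} {ω : Matrix h₂ h₁ ℂ}
    (hinv : ∀ x : (i : ι) → Mat (A i),
      krausMap U (piAmplR h₂ (krausMap V) fun i => tensorState (x i) (pureState ω)) = x) :
    IsBlockScalar V U ω := by
  classical
  let K : ∀ i i', (Σ j, F j i' × E i j) → Matrix (A i') (A i) ℂ :=
    fun i i' r => U r.1 i' r.2.1 * attach ω (V i r.1 r.2.2)
  have hK : ∀ i i' (y : Mat (A i)), ∑ r, K i i' r * y * (K i i' r)ᴴ =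
      (Pi.single i y : (i : ι) → Mat (A i)) i' := by
    intro i i' y
    conv_rhs => rw [← hinv (Pi.single i y), krausMap_piAmplR_krausMap]
    rw [Fintype.sum_sigma]
    refine Finset.sum_congr rfl fun j _ => ?_
    rw [Fintype.sum_prod_type]
    refine Finset.sum_congr rfl fun t _ => ?_
    rw [Finset.sum_eq_single i (fun i₁ _ hne => by simp [hne]) (by simp)]
    simp [K]
  constructor
  · intro j i t s
    exact kraus_eq_smul_one (K := K i i) (fun y => by simp [hK]) ⟨j, t, s⟩
  · intro j i i' t s hne
    exact kraus_eq_zero (K := K i i') (fun y => by simp [hK, hne]) ⟨j, t, s⟩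

theorem inverse_of_isBlockScalar [Fintype κ] [∀ i j, Fintype (E i j)]
    [∀ i, Nonempty (A i)]
    {V : ∀ i j, E i j → Matrix (B j) (A i × h₁) ℂ}
    {U : ∀ j i, F j i → Matrix (A i) (B j × h₂) ℂ} {ω : Matrix h₂ h₁ ℂ}
    (hV : ∀ x, ∑ j, (krausMap V x j).trace = ∑ i, (x i).trace)
    (hU : ∀ y, ∑ i, (krausMap U y i).trace = ∑ j, (y j).trace)
    (hω : (pureState ω).trace = 1) (hVU : IsBlockScalar V U ω) (x : (i : ι) → Mat (A i)) :
    krausMap U (piAmplR h₂ (krausMap V) fun i => tensorState (x i) (pureState ω)) = x := by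
  classical
  obtain ⟨hdiag, hoff⟩ := hVU
  choose c hc using hdiag
  let γ : ι → ℂ := fun i => ∑ j, ∑ t, ∑ s, c j i t s * star (c j i t s)
  have key : ∀ (x : (i : ι) → Mat (A i)) i', krausMap U (piAmplR h₂ (krausMap V)
      fun i => tensorState (x i) (pureState ω)) i' = γ i' • x i' := by
    intro x i'
    rw [krausMap_piAmplR_krausMap, Finset.sum_smul]
    refine Finset.sum_congr rfl fun j _ => ?_
    rw [Finset.sum_smul]
    refine Finset.sum_congr rfl fun t _ => ?_
    rw [Finset.sum_eq_single i' (fun i _ hne => by simp [hoff j i i' t _ hne.symm]) (by simp),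
      Finset.sum_smul]
    refine Finset.sum_congr rfl fun s _ => ?_
    simp [hc, smul_smul, mul_comm]
  have hγ : ∀ i, γ i = 1 := by
    intro i
    have htr := hU (piAmplR h₂ (krausMap V)
      fun i' => tensorState ((Pi.single i 1 : (i : ι) → Mat (A i)) i') (pureState ω))
    rw [sum_trace_piAmplR hV] at htr
    simp only [key, trace_tensorState, hω, mul_one, Matrix.trace_smul] at htr
    rw [Finset.sum_eq_single i (fun i' _ hne => by simp [hne]) (by simp),
      Finset.sum_eq_single i (fun i' _ hne => by simp [hne]) (by simp)] at htr
    simpa using htr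
  funext i
  rw [key, hγ, one_smul]

theorem IsBlockScalar.attach_eq [∀ j, DecidableEq (B j)] [DecidableEq h₂]
    {V : ∀ i j, E i j → Matrix (B j) (A i × h₁) ℂ}
    {U : ∀ j i, F j i → Matrix (A i) (B j × h₂) ℂ} {ω : Matrix h₂ h₁ ℂ}
    (hVU : IsBlockScalar V U ω) (hU : ∀ j, ∑ i, ∑ t, (U j i t)ᴴ * U j i t = 1) (i : ι) (j : κ) :
    ∃ η : F j i → E i j → ℂ, ∀ s, attach ω (V i j s) = ∑ t, η t s • (U j i t)ᴴ := by
  choose c hc using hVU.1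
  refine ⟨c j i, fun s => ?_⟩
  calc attach ω (V i j s)
      = (∑ i', ∑ t, (U j i' t)ᴴ * U j i' t) * attach ω (V i j s) := by rw [hU, Matrix.one_mul]
    _ = ∑ i', ∑ t, (U j i' t)ᴴ * (U j i' t * attach ω (V i j s)) := by
        simp only [Matrix.sum_mul, Matrix.mul_assoc]
    _ = ∑ t, (U j i t)ᴴ * (U j i t * attach ω (V i j s)) :=
        Finset.sum_eq_single i (fun i' _ hne => by simp [hVU.2 j i i' _ s hne]) (by simp)
    _ = _ := by simp [hc]

/-- If two channels are mutually inverse through `w_ω`, the Kraus operators of the second one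
intertwine `1 ⊗ ωω†` with an operator on their index space. -/
theorem exists_intertwiner [Fintype κ] [∀ i j, Fintype (E i j)]
    [∀ j, DecidableEq (B j)] [DecidableEq h₁] [DecidableEq h₂]
    {V : ∀ i j, E i j → Matrix (B j) (A i × h₁) ℂ}
    {U : ∀ j i, F j i → Matrix (A i) (B j × h₂) ℂ} {ω : Matrix h₂ h₁ ℂ}
    (hVU : IsBlockScalar V U ω) (hUV : IsBlockScalar U V ωᵀ)
    (hV : ∀ i, ∑ j, ∑ s, (V i j s)ᴴ * V i j s = 1)
    (hU : ∀ j, ∑ i, ∑ t, (U j i t)ᴴ * U j i t = 1) (i : ι) (j : κ) :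
    ∃ Q : Mat (F j i), ∀ t,
      U j i t * ((1 : Mat (B j)) ⊗ₖ (ω * ωᴴ)) = ∑ t', Q t t' • U j i t' := by
  obtain ⟨η, hη⟩ := hVU.attach_eq hU i j
  obtain ⟨θ, hθ⟩ := hUV.attach_eq hV j i
  refine ⟨Matrix.of fun t t' => ∑ s, θ s t * star (η t' s), fun t => ?_⟩
  rw [← attach_conjTranspose_attach, hθ]
  simp only [conjTranspose_sum, conjTranspose_smul, conjTranspose_conjTranspose, attach_sum_smul,
    hη, of_apply, Finset.sum_smul, Finset.smul_sum, smul_smul]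
  rw [Finset.sum_comm]
  simp only [StarMul.star_mul, star_star, mul_comm]

end Inverse

theorem canME_eq_pureState (h : ℕ) :
    canME h = pureState (((Real.sqrt h : ℝ) : ℂ)⁻¹ • (1 : Mat (Fin h))) := by
  have : omegaVec h = pureVec (((Real.sqrt h : ℝ) : ℂ)⁻¹ • (1 : Mat (Fin h))) := by
    funext p
    simp [omegaVec, pureVec, Matrix.one_apply, eq_comm]
  rw [canME, pureState, this]

theorem trace_canME {h : ℕ} (hh : 1 ≤ h) : (canME h).trace = 1 := by
  have hpos : (0 : ℝ) < h := by exact_mod_cast hh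
  have hs : ((Real.sqrt h : ℝ) : ℂ) * ((Real.sqrt h : ℝ) : ℂ) = h := by
    rw [← Complex.ofReal_mul, Real.mul_self_sqrt hpos.le, Complex.ofReal_natCast]
  have hne : (h : ℂ) ≠ 0 := by exact_mod_cast hpos.ne'
  simp only [canME, outer, omegaVec, Matrix.trace, diag_apply, vecMulVec_apply, Pi.star_apply,
    Fintype.sum_prod_type]
  simp [← mul_inv, hs, hne]


/-- **Entanglement-invertibility with respect to a pure state with invertible `ω`
implies entanglement-invertibility with respect to the canonical maximally
entangled state.** -/
theorem entanglement_invertible_pure_to_canonical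
    {m n : ℕ} (a : Fin m → ℕ) (b : Fin n → ℕ)
    (ha : ∀ i, 1 ≤ a i) (hb : ∀ j, 1 ≤ b j)
    (h : ℕ) (hh : 1 ≤ h)
    (ω : Mat (Fin h)) (hωinv : IsUnit ω) (hωtr : (ωᴴ * ω).trace = 1)
    (M : ((i : Fin m) → Mat (Fin (a i) × Fin h)) →ₗ[ℂ] (j : Fin n) → Mat (Fin (b j)))
    (hM : PiIsChannel M) (hinv : PiEntInvertible M (pureState ω)) :
    PiEntInvertible M (canME h) := by
  classical
  have hA : ∀ i, Nonempty (Fin (a i)) := fun i => ⟨⟨0, ha i⟩⟩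
  have hB : ∀ j, Nonempty (Fin (b j)) := fun j => ⟨⟨0, hb j⟩⟩
  obtain ⟨N, hN, hleft, hright⟩ := hinv
  obtain ⟨e, V, rfl⟩ := hM.1.exists_krausMap
  obtain ⟨f, U, rfl⟩ := hN.1.exists_krausMap
  have hVone := (krausMap_tracePreserving_iff V).mp hM.2
  have hUone := (krausMap_tracePreserving_iff U).mp hN.2
  have hVU : IsBlockScalar V U ω := isBlockScalar_of_inverse hleft
  have hUV : IsBlockScalar U V ωᵀ := isBlockScalar_of_inverse hright
  obtain ⟨q, hq⟩ := exists_polynomial_polar hωinv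
  set P : Mat (Fin h) := Polynomial.aeval (ω * ωᴴ) q
  have hR : ∀ j i, ∃ R : Mat (Fin (f j i)), ∀ t,
      U j i t * ((1 : Mat (Fin (b j))) ⊗ₖ P) = ∑ t', R t t' • U j i t' := by
    intro j i
    obtain ⟨Q, hQ⟩ := exists_intertwiner hVU hUV hVone hUone i j
    exact ⟨Polynomial.aeval Q q, intertwine_aeval hQ q⟩
  choose R hR using hR
  set w : Mat (Fin h) := P * ω with hw
  set r : ℂ := ((Real.sqrt h : ℝ) : ℂ)⁻¹
  let U' : ∀ j i, Fin (f j i) → Matrix (Fin (a i)) (Fin (b j) × Fin h) ℂ :=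
    fun j i t => U j i t * ((1 : Mat (Fin (b j))) ⊗ₖ w)
  have hU'one : ∀ j, ∑ i, ∑ t, (U' j i t)ᴴ * U' j i t = 1 := by
    intro j
    calc _ = ((1 : Mat (Fin (b j))) ⊗ₖ w)ᴴ * (∑ i, ∑ t, (U j i t)ᴴ * U j i t) *
          ((1 : Mat (Fin (b j))) ⊗ₖ w) := by
          simp only [U', Matrix.mul_sum, Matrix.sum_mul, conjTranspose_mul, Matrix.mul_assoc]
      _ = 1 := by
          rw [hUone, Matrix.mul_one, conjTranspose_kronecker, ← mul_kronecker_mul, hq]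
          simp
  have hU'tp := (krausMap_tracePreserving_iff U').mpr hU'one
  have hleft' : ∀ j i i' t s, U' j i' t * attach (r • (1 : Mat (Fin h))) (V i j s) =
      ∑ t', (r * R j i' t t') • (U j i' t' * attach ω (V i j s)) := by
    intro j i i' t s
    have hscal : w * r • (1 : Mat (Fin h)) = P * (r • ω) := by simp [hw]
    have hsm : attach (r • ω) (V i j s) = r • attach ω (V i j s) := by
      ext y x
      simp [attach, Finset.mul_sum, mul_assoc]
    rw [Matrix.mul_assoc, kronecker_mul_attach, hscal, ← kronecker_mul_attach,
      ← Matrix.mul_assoc, hR, hsm]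
    simp [Matrix.sum_mul, smul_smul, Finset.smul_sum]
  have hright' : ∀ i j j' t s, V i j' s * attach (r • (1 : Mat (Fin h)))ᵀ (U' j i t) =
      ∑ t', (r * R j i t t') • (V i j' s * attach ωᵀ (U j i t')) := by
    intro i j j' t s
    have hscal : (r • (1 : Mat (Fin h)))ᵀ * wᵀ = (r • ωᵀ) * Pᵀ := by simp [hw]
    have hsm : ∀ t', attach (r • ωᵀ) (U j i t') = r • attach ωᵀ (U j i t') := by
      intro t'
      ext y x
      simp [attach, Finset.mul_sum, mul_assoc]
    rw [attach_mul_kronecker, hscal, ← attach_mul_kronecker, hR, attach_sum_smul]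
    simp [hsm, Matrix.mul_sum, smul_smul, mul_comm]
  have hVU' : IsBlockScalar V U' (r • (1 : Mat (Fin h))) := by
    choose c hc using hVU.1
    refine ⟨fun j i t s => ⟨∑ t', r * R j i t t' * c j i t' s, ?_⟩, fun j i i' t s hne => ?_⟩
    · simp only [hleft', hc, smul_smul, Finset.sum_smul]
    · simp [hleft', hVU.2 j i i' _ s hne]
  have hUV' : IsBlockScalar U' V (r • (1 : Mat (Fin h)))ᵀ := by
    choose c hc using hUV.1
    refine ⟨fun i j s t => ⟨∑ t', r * R j i t t' * c i j s t', ?_⟩, fun i j j' s t hne => ?_⟩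
    · simp only [hright', hc, smul_smul, Finset.sum_smul]
    · simp only [hright', hUV.2 i j j' s _ hne, smul_zero, Finset.sum_const_zero]
  have htr := trace_canME hh
  rw [canME_eq_pureState] at htr ⊢
  refine ⟨krausMap U', ⟨krausMap_piIsCP U', hU'tp⟩, ?_, ?_⟩
  · exact inverse_of_isBlockScalar hM.2 hU'tp htr hVU'
  · have htr' : (pureState (r • (1 : Mat (Fin h)))ᵀ).trace = 1 := by
      rw [transpose_smul, transpose_one]
      exact htr
    intro y
    rw [swapState_pureState]
    exact inverse_of_isBlockScalar hU'tp hM.2 htr' hUV' y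

end EntInvPaper
end
end
end
end
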